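/- Define ν : ℤ → ℝ by ν(k) = 1/(k²-1) for every even integer k ≠ 0 and ν(k) = 0 otherwise. Then ν is a symmetric probability distribution on ℤ, its characteristic function is φ_ν(θ) = 1 - (π/2)·|sin θ| for all θ ∈ ℝ, and h_1^{(1)} is ν-harmonic on ℤ_{>0}. -/

import Mathlib

open scoped BigOperators

noncomputable def h0 (r : ℝ) (l : ℤ) : ℝ :=
  if 0 ≤ l then
    (4 : ℝ) ^ (-l) *
      ∑ m ∈ Finset.range (l.toNat + 1),
        (Nat.choose (2 * m) m : ℝ) * (Nat.choose (2 * (l.toNat - m)) (l.toNat - m) : ℝ) *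
          (-r) ^ (l.toNat - m)
  else 0

noncomputable def h1 (r : ℝ) (l : ℤ) : ℝ :=
  if 1 ≤ l then ∑ p ∈ Finset.range l.toNat, h0 r (p : ℤ) else 0

noncomputable def h2 (r : ℝ) (l : ℤ) : ℝ :=
  if 2 ≤ l then ∑ p ∈ Finset.Icc 1 (l.toNat - 1), h1 r (p : ℤ) else 0

noncomputable def hm1 (r : ℝ) (l : ℤ) : ℝ := h0 r (l + 1) - h0 r l

noncomputable def hm2 (r : ℝ) (l : ℤ) : ℝ := hm1 r (l + 1) - hm1 r l

noncomputable def kernelR (r : ℝ) (k m : ℤ) : ℝ :=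
  ∑ p ∈ Finset.range m.toNat,
    h1 r (m - (p : ℤ)) * (hm2 r (k + (p : ℤ) - 1) + r * hm2 r (k + (p : ℤ) - 2))

/-- `ν` is a probability distribution on `ℤ`. -/
def IsProbDist (ν : ℤ → ℝ) : Prop := (∀ k, 0 ≤ ν k) ∧ HasSum ν 1

/-- A nonnegative function `f : ℤ → [0,∞)` is `ν`-harmonic on `ℤ_{>0}`. -/
def NuHarmonic (ν : ℤ → ℝ) (f : ℤ → ℝ) : Prop :=
  (∀ l, 0 ≤ f l) ∧ ∀ k : ℤ, 1 ≤ k → HasSum (fun l : ℤ => f (k + l) * ν l) (f k)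

noncomputable def Lnu (r : ℝ) (ν : ℤ → ℝ) : ℝ :=
  ∑' k : ℕ, ν ((k : ℤ) + 1) * h2 r ((k : ℤ) + 2)

noncomputable def phiNu (ν : ℤ → ℝ) (θ : ℝ) : ℂ :=
  ∑' k : ℤ, (ν k : ℂ) * Complex.exp (Complex.I * (k : ℂ) * (θ : ℂ))

/-- The symmetric critical step distribution `ν(k) = 1/(k²-1)` for even `k ≠ 0`. -/
noncomputable def nuSym : ℤ → ℝ := fun k =>
  if k ≠ 0 ∧ (2 : ℤ) ∣ k then 1 / ((k : ℝ) ^ 2 - 1) else 0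


noncomputable def cbP : PowerSeries ℝ := PowerSeries.mk fun n => (Nat.centralBinom n : ℝ)
noncomputable def cbM : PowerSeries ℝ := PowerSeries.mk fun n => (Nat.centralBinom n : ℝ) * (-1)^n

lemma cbrec (n : ℕ) : ((n:ℝ)+1) * (Nat.centralBinom (n+1) : ℝ) = 2*(2*n+1)*Nat.centralBinom n := by
  exact_mod_cast Nat.succ_mul_centralBinom_succ n

open PowerSeries in
lemma cbP_d : (1 - C (4:ℝ) * X) * derivative ℝ cbP = C (2:ℝ) * cbP := by
  ext n
  rw [sub_mul, one_mul, mul_assoc]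
  rcases n with _ | n
  · rw [map_sub, coeff_C_mul, coeff_C_mul, coeff_zero_X_mul, coeff_derivative]; simp [cbP, Nat.centralBinom]
  · simp only [map_sub, coeff_C_mul, coeff_succ_X_mul, coeff_derivative, cbP, coeff_mk]
    have := cbrec (n+1)
    push_cast at *
    linarith

open PowerSeries in
lemma cbM_d : (1 + C (4:ℝ) * X) * derivative ℝ cbM = - C (2:ℝ) * cbM := by
  ext n
  rw [add_mul, one_mul, mul_assoc, neg_mul]
  rcases n with _ | n
  · rw [map_add, map_neg, coeff_C_mul, coeff_C_mul, coeff_zero_X_mul, coeff_derivative]; simp [cbM, Nat.centralBinom]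
  · simp only [map_add, map_neg, coeff_C_mul, coeff_succ_X_mul, coeff_derivative, cbM, coeff_mk]
    have := cbrec (n+1)
    push_cast at *
    rw [pow_succ, pow_succ]
    linear_combination (-1)^n * this

open PowerSeries in
lemma prod_d : (1 - C (16:ℝ) * X * X) * derivative ℝ (cbP * cbM) = C (16:ℝ) * X * (cbP * cbM) := by
  have h16 : (C (16:ℝ) : PowerSeries ℝ) = 16 := map_ofNat C 16
  have h4 : (C (4:ℝ) : PowerSeries ℝ) = 4 := map_ofNat C 4
  have h2 : (C (2:ℝ) : PowerSeries ℝ) = 2 := map_ofNat C 2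
  have h1 := cbP_d
  have h3 := cbM_d
  rw [Derivation.leibniz]
  simp only [smul_eq_mul]
  rw [h4, h2] at *
  rw [h16]
  linear_combination (1+4*X) * cbM * h1 + (1-4*X)*cbP * h3

open PowerSeries in
lemma prod_rec (l : ℕ) : ((l:ℝ)+2) * coeff (l+2) (cbP * cbM) = 16 * (l+1) * coeff l (cbP*cbM) := by
  have h := congrArg (coeff (l+1)) prod_d
  rw [sub_mul, one_mul, mul_assoc, mul_assoc, mul_assoc] at h
  rw [map_sub, coeff_C_mul, coeff_C_mul, coeff_succ_X_mul, coeff_succ_X_mul, coeff_derivative] at h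
  rcases l with _ | l
  · simp at *
    linarith
  · rw [coeff_succ_X_mul, coeff_derivative] at h
    push_cast at *
    linarith

open PowerSeries in
lemma prod_coeff (m : ℕ) : coeff (2*m) (cbP*cbM) = 4^m * (Nat.centralBinom m : ℝ) ∧
    coeff (2*m+1) (cbP*cbM) = 0 := by
  induction m with
  | zero =>
    constructor
    · simp [cbP, cbM, coeff_mul, Nat.centralBinom]
    · rw [coeff_mul, Finset.Nat.sum_antidiagonal_eq_sum_range_succ_mk]; simp [cbP, cbM, Finset.sum_range_succ, Nat.centralBinom]
  | succ m ih =>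
    have h1 := prod_rec (2*m)
    have h2 := prod_rec (2*m+1)
    rw [ih.1] at h1
    rw [ih.2] at h2
    have := cbrec m
    constructor
    · have h0 : (2*(m:ℝ)+2) ≠ 0 := by positivity
      rw [show 2*(m+1) = 2*m+2 by ring]
      apply mul_left_cancel₀ h0
      push_cast at *
      rw [h1]
      rw [pow_succ]
      linear_combination -8 * 4^m * this
    · rw [show 2*(m+1)+1 = 2*m+1+2 by ring]
      have h0 : ((2*m+1:ℕ):ℝ)+2 ≠ 0 := by positivity
      apply mul_left_cancel₀ h0
      rw [h2]; ring

noncomputable def cc (m : ℕ) : ℝ := (Nat.centralBinom m : ℝ) / 4^m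

lemma h0_eq (l : ℕ) : h0 1 (l:ℤ) = (4^l)⁻¹ * PowerSeries.coeff l (cbP*cbM) := by
  unfold h0
  rw [if_pos (by positivity), PowerSeries.coeff_mul, Finset.Nat.sum_antidiagonal_eq_sum_range_succ_mk]
  simp [cbP, cbM, Nat.centralBinom, mul_assoc]

lemma h0_even (m : ℕ) : h0 1 ((2*m : ℕ):ℤ) = cc m := by
  rw [h0_eq, (prod_coeff m).1, cc, pow_mul]
  have : (4:ℝ)^m ≠ 0 := by positivity
  rw [show (4:ℝ)^2 = 4*4 by norm_num, mul_pow]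
  field_simp

lemma h0_odd (m : ℕ) : h0 1 ((2*m+1 : ℕ):ℤ) = 0 := by
  rw [h0_eq, (prod_coeff m).2, mul_zero]

lemma cc_rec (m : ℕ) : (2*(m:ℝ)+2) * cc (m+1) = (2*m+1) * cc m := by
  have := cbrec m
  unfold cc
  rw [pow_succ]
  field_simp
  linarith

lemma cc_nonneg (m : ℕ) : 0 ≤ cc m := by unfold cc; positivity

lemma cc_sq (m : ℕ) : (2*(m:ℝ)+1) * cc m ^ 2 ≤ 1 := by
  induction m with
  | zero => simp [cc]
  | succ m ih =>
    have h := cc_rec m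
    have h2 : ((2*(m:ℝ)+2) * cc (m+1))^2 = ((2*m+1) * cc m)^2 := by rw [h]
    have hm : (0:ℝ) ≤ m := by positivity
    push_cast
    have h3 : (2*(m:ℝ)+2)^2 * cc (m+1)^2 ≤ 2*m+1 := by nlinarith
    have h4 : (2*(m:ℝ)+1)*(2*m+3) * cc (m+1)^2 ≤ 2*m+1 := by nlinarith [sq_nonneg (cc (m+1))]
    have : (0:ℝ) < 2*m+1 := by positivity
    by_contra hc
    push Not at hc
    nlinarith

open Filter Topology in
lemma cc_tendsto : Tendsto cc atTop (𝓝 0) := by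
  have : Tendsto (fun m => cc m ^ 2) atTop (𝓝 0) := by
    refine squeeze_zero (fun m => sq_nonneg _) (fun m => ?_) tendsto_one_div_add_atTop_nhds_zero_nat
    rw [le_div_iff₀ (by positivity)]
    have := cc_sq m
    nlinarith [sq_nonneg (cc m), (Nat.cast_nonneg m : (0:ℝ) ≤ m)]
  have h2 := this.sqrt
  simpa [Real.sqrt_sq (cc_nonneg _)] using h2

lemma h1_sum (m : ℕ) : ∑ p ∈ Finset.range (2*m+1), h0 1 (p:ℤ) = (2*m+1) * cc m ∧
    ∑ p ∈ Finset.range (2*m+2), h0 1 (p:ℤ) = (2*m+1) * cc m := by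
  have key : ∀ m : ℕ, ∑ p ∈ Finset.range (2*m+1), h0 1 (p:ℤ) = (2*m+1) * cc m →
    ∑ p ∈ Finset.range (2*m+2), h0 1 (p:ℤ) = (2*m+1) * cc m := by
    intro m h
    rw [Finset.sum_range_succ, h, h0_odd, add_zero]
  refine ⟨?_, key m ?_⟩ <;>
  · induction m with
    | zero => have := h0_even 0; simp at *; exact this
    | succ m ih =>
      rw [Finset.sum_range_succ, show 2*(m+1) = 2*m+2 by ring, key m ih]
      rw [show 2*m+2 = 2*(m+1) by ring, h0_even]
      have := cc_rec m
      push_cast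
      linarith

lemma h1_odd (m : ℕ) : h1 1 (2*(m:ℤ)+1) = (2*m+1) * cc m := by
  unfold h1
  rw [if_pos (by omega), show (2*(m:ℤ)+1).toNat = 2*m+1 by omega]
  exact (h1_sum m).1
lemma h1_even (m : ℕ) : h1 1 (2*(m:ℤ)+2) = (2*m+1) * cc m := by
  unfold h1
  rw [if_pos (by omega), show (2*(m:ℤ)+2).toNat = 2*m+2 by omega]
  exact (h1_sum m).2

lemma h1_neg (l : ℤ) (h : l ≤ 0) : h1 1 l = 0 := by
  unfold h1; rw [if_neg (by omega)]

lemma h1_nonneg (l : ℤ) : 0 ≤ h1 1 l := by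
  rcases le_or_gt l 0 with h | h
  · rw [h1_neg l h]
  · obtain ⟨m, hm | hm⟩ : ∃ m : ℕ, l = 2*m+1 ∨ l = 2*m+2 := ⟨((l-1)/2).toNat, by omega⟩
    · rw [hm, h1_odd]; have := cc_nonneg m; positivity
    · rw [hm, h1_even]; have := cc_nonneg m; positivity
lemma sn (k : ℤ) : (2*(k:ℝ)-1) ≠ 0 := by
  have : (2*k-1:ℤ) ≠ 0 := by omega
  exact_mod_cast this
lemma sp (k : ℤ) : (2*(k:ℝ)+1) ≠ 0 := by
  have : (2*k+1:ℤ) ≠ 0 := by omega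
  exact_mod_cast this

noncomputable def absSinC : C(AddCircle Real.pi, ℂ) where
  toFun := Function.Periodic.lift (f := fun x : ℝ => ((|Real.sin x| : ℝ) : ℂ)) (c := Real.pi)
    (by intro x; simp [Real.sin_add_pi])
  continuous_toFun := by
    apply Continuous.quotient_lift
    fun_prop

instance factpi : Fact (0 < Real.pi) := ⟨Real.pi_pos⟩

lemma absSinC_coe (x : ℝ) : absSinC (x : AddCircle Real.pi) = ((|Real.sin x| : ℝ) : ℂ) := rfl

lemma coefC (n : ℤ) : fourierCoeff absSinC n = ((-2 / Real.pi * (1 / ((2*(n:ℝ))^2-1)) : ℝ) : ℂ) := by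
  rw [fourierCoeff_eq_intervalIntegral _ n 0, zero_add]
  have hpi : (Real.pi : ℂ) ≠ 0 := by exact_mod_cast Real.pi_ne_zero
  have e : ∀ x ∈ Set.uIcc 0 Real.pi, (fourier (-n) (x : AddCircle Real.pi) • absSinC (x : AddCircle Real.pi) : ℂ)
      = (Complex.exp ((Complex.I * (1-2*n)) * x) - Complex.exp ((-Complex.I * (1+2*n)) * x)) * (1/(2 * Complex.I)) := by
    intro x hx
    rw [Set.uIcc_of_le Real.pi_pos.le] at hx
    rw [absSinC_coe, abs_of_nonneg (Real.sin_nonneg_of_mem_Icc hx), fourier_coe_apply, Complex.ofReal_sin, Complex.sin, smul_eq_mul]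
    have e1 : Complex.exp ((Complex.I * (1-2*n)) * x) = Complex.exp (2 * Real.pi * Complex.I * (-n:ℤ) * x / Real.pi) * Complex.exp (x * Complex.I) := by
      rw [← Complex.exp_add]; congr 1; push_cast; field_simp; ring
    have e2 : Complex.exp ((-Complex.I * (1+2*n)) * x) = Complex.exp (2 * Real.pi * Complex.I * (-n:ℤ) * x / Real.pi) * Complex.exp (-x * Complex.I) := by
      rw [← Complex.exp_add]; congr 1; push_cast; field_simp; ring
    rw [e1, e2]
    have := Complex.I_mul_I
    field_simp
    ring_nf
    simp
    try ring
  have a1 : (1 - 2*(n:ℂ)) ≠ 0 := by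
    have : (1-2*n:ℤ) ≠ 0 := by omega
    exact_mod_cast this
  have a2 : (1 + 2*(n:ℂ)) ≠ 0 := by
    have : (1+2*n:ℤ) ≠ 0 := by omega
    exact_mod_cast this
  have a3 : (2*(n:ℂ))^2 - 1 ≠ 0 := by
    have : (2*(n:ℂ))^2 - 1 = -((1 - 2*(n:ℂ)) * (1 + 2*(n:ℂ))) := by ring
    rw [this]; exact neg_ne_zero.mpr (mul_ne_zero a1 a2)
  have b1 : Complex.I * (1-2*n) ≠ 0 := mul_ne_zero Complex.I_ne_zero a1
  have b2 : -Complex.I * (1+2*n) ≠ 0 := mul_ne_zero (neg_ne_zero.mpr Complex.I_ne_zero) a2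
  rw [intervalIntegral.integral_congr e, intervalIntegral.integral_mul_const, intervalIntegral.integral_sub,
    integral_exp_mul_complex b1, integral_exp_mul_complex b2]
  · have c1 : Complex.exp ((Complex.I * (1-2*n)) * Real.pi) = -1 := by
      rw [show (Complex.I * (1-2*n)) * Real.pi = Real.pi * Complex.I + (-n:ℤ) * (2 * Real.pi * Complex.I) by push_cast; ring,
        Complex.exp_add, Complex.exp_pi_mul_I, Complex.exp_int_mul_two_pi_mul_I]; ring
    have c2 : Complex.exp ((-Complex.I * (1+2*n)) * Real.pi) = -1 := by
      rw [show (-Complex.I * (1+2*n)) * Real.pi = Real.pi * Complex.I + (-n-1:ℤ) * (2 * Real.pi * Complex.I) by push_cast; ring,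
        Complex.exp_add, Complex.exp_pi_mul_I, Complex.exp_int_mul_two_pi_mul_I]; ring
    rw [c1, c2]
    rw [Complex.real_smul]
    push_cast
    simp only [mul_zero, Complex.exp_zero]
    have hI := Complex.I_ne_zero
    have : (-1 - 1) / (Complex.I * (1 - 2 * (n:ℂ))) - (-1 - 1) / (-Complex.I * (1 + 2 * (n:ℂ))) = (2 * Complex.I) * (-2/((2*(n:ℂ))^2-1)) := by
      rw [div_sub_div _ _ b1 b2, mul_div_assoc', div_eq_div_iff (mul_ne_zero b1 b2) a3]
      linear_combination (Complex.I * (16*(n:ℂ)^2-4)) * Complex.I_sq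
    rw [this]
    field_simp
  all_goals
    apply Continuous.intervalIntegrable
    fun_prop

lemma summ : Summable fun n : ℤ => (1 / ((2*(n:ℝ))^2-1)) := by
  have h : Summable fun n : ℤ => 1 / (n:ℝ)^2 := Real.summable_one_div_int_pow.mpr (by norm_num)
  refine Summable.of_norm_bounded_eventually (g := fun n : ℤ => 1 / (n:ℝ)^2) h ?_
  rw [Filter.eventually_cofinite]
  refine (Set.finite_singleton (0:ℤ)).subset ?_
  intro n hn
  by_contra h0
  apply hn
  have h1 : (1:ℝ) ≤ (n:ℝ)^2 := by
    have : (1:ℤ) ≤ n^2 := by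
      have : n ≠ 0 := h0
      have := sq_pos_of_ne_zero this
      omega
    exact_mod_cast this
  rw [Real.norm_of_nonneg (by apply div_nonneg <;> nlinarith)]
  apply one_div_le_one_div_of_le <;> nlinarith

lemma hasSum_full (θ : ℝ) : HasSum (fun n : ℤ => ((1 / ((2*(n:ℝ))^2-1) : ℝ) : ℂ) * Complex.exp (Complex.I * ((2*n:ℤ):ℂ) * θ))
    ((-(Real.pi/2 * |Real.sin θ|) : ℝ) : ℂ) := by
  have hpi : (Real.pi : ℂ) ≠ 0 := by exact_mod_cast Real.pi_ne_zero
  have hs : Summable (fourierCoeff absSinC) := by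
    have := (summ.mul_left (-2/Real.pi))
    have h2 := Complex.ofRealCLM.summable this
    refine h2.congr ?_
    intro n
    rw [coefC]; rfl
  have h := (has_pointwise_sum_fourier_series_of_summable hs (θ : AddCircle Real.pi)).mul_left (-(Real.pi:ℂ)/2)
  rw [absSinC_coe] at h
  refine (congrArg₂ (fun f a => HasSum f a) ?_ ?_).mpr h
  · funext n
    rw [coefC, fourier_coe_apply, smul_eq_mul]
    rw [show 2 * (Real.pi:ℂ) * Complex.I * n * θ / Real.pi = Complex.I * ((2*n:ℤ):ℂ) * θ by push_cast; field_simp]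
    push_cast
    field_simp
  · push_cast; ring

lemma hasSum_nu (θ : ℝ) : HasSum (fun k : ℤ => (nuSym k : ℂ) * Complex.exp (Complex.I * (k : ℂ) * (θ : ℂ)))
    ((1 - Real.pi / 2 * |Real.sin θ| : ℝ) : ℂ) := by
  have h := (hasSum_full θ).update 0 0
  have hinj : Function.Injective (fun n : ℤ => 2*n) := fun a b h => by simpa using h
  rw [← hinj.hasSum_iff]
  · refine (congrArg₂ (fun f a => HasSum f a) ?_ ?_).mpr h
    · funext n
      by_cases hn : n = 0
      · subst hn; simp [nuSym]
      · simp [nuSym, hn]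
    · simp; ring
  · intro k hk
    have : nuSym k = 0 := by
      unfold nuSym
      rw [if_neg]
      rintro ⟨_, m, hm⟩
      exact hk ⟨m, hm.symm⟩
    rw [this]; simp

lemma nu_nonneg (k : ℤ) : 0 ≤ nuSym k := by
  unfold nuSym
  split_ifs with h
  · have h1 : (1:ℝ) ≤ (k:ℝ)^2 := by
      have : (1:ℤ) ≤ k^2 := by
        have := sq_pos_of_ne_zero h.1
        omega
      exact_mod_cast this
    apply div_nonneg <;> linarith
  · exact le_rfl

lemma nu_prob : IsProbDist nuSym := by
  refine ⟨nu_nonneg, ?_⟩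
  have h := hasSum_nu 0
  simp only [Complex.ofReal_zero, mul_zero, Complex.exp_zero, mul_one, Real.sin_zero, abs_zero, sub_zero] at h
  exact_mod_cast h

open Filter Topology in
lemma bdry (n : ℕ) : Tendsto (fun M : ℕ => (M:ℝ) * cc M / (2 * M - 2*n-1)) atTop (𝓝 0) := by
  have h := (cc_tendsto.norm)
  rw [norm_zero] at h
  refine squeeze_zero_norm' ?_ h
  filter_upwards [eventually_ge_atTop (2*n+1)] with M hM
  have hM' : 2*(n:ℝ)+1 ≤ M := by exact_mod_cast hM
  have hM0 : (0:ℝ) ≤ M := by positivity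
  have hn0 : (0:ℝ) ≤ n := by positivity
  have hc := cc_nonneg M
  rw [Real.norm_of_nonneg (div_nonneg (by positivity) (by linarith)), Real.norm_of_nonneg hc,
    div_le_iff₀ (by linarith)]
  nlinarith

noncomputable def TT (n M : ℕ) : ℝ := ∑ m ∈ Finset.range M, cc m / (2*m - 2*n - 1)

lemma odd_ne (m n : ℕ) : (2*(m:ℝ) - 2*n - 1) ≠ 0 := by
  have := sn ((m:ℤ)-n)
  push_cast at this
  intro h; apply this; linarith
lemma odd_ne' (m n : ℕ) : (2*(m:ℝ) - 2*n + 1) ≠ 0 := by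
  have := sp ((m:ℤ)-n)
  push_cast at this
  intro h; apply this; linarith

lemma TT_zero (M : ℕ) : TT 0 M = - (2 * (M * cc M / (2*M-2*(0:ℕ)-1))) := by
  induction M with
  | zero => simp [TT]
  | succ M ih =>
    have h1 := odd_ne M 0
    have h2 := odd_ne (M+1) 0
    have h : ((M:ℝ)+1) * cc (M+1) = (2*M+1)*cc M/2 := by linarith [cc_rec M]
    unfold TT at *
    rw [Finset.sum_range_succ, ih]
    push_cast at h1 h2 ⊢
    rw [h]
    simp only [mul_zero, sub_zero] at h1 h2 ⊢
    have h3 : 2*((M:ℝ)+1)-1 = 2*M+1 := by ring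
    rw [h3] at h2 ⊢
    field_simp
    ring

lemma TT_succ (n M : ℕ) : (2*(n:ℝ)+3) * TT (n+1) M = (2*n+2) * TT n M - 2 * (M * cc M / (2*M-2*(n+1:ℕ)-1)) := by
  induction M with
  | zero => simp [TT]
  | succ M ih =>
    have h1 := odd_ne M n
    have h2 := odd_ne M (n+1)
    have h : ((M:ℝ)+1) * cc (M+1) = (2*M+1)*cc M/2 := by linarith [cc_rec M]
    unfold TT at *
    rw [Finset.sum_range_succ, Finset.sum_range_succ, mul_add, mul_add, ih]
    have h3 : 2*((M+1:ℕ):ℝ)-2*(n+1:ℕ)-1 = 2*M - 2*n-1 := by push_cast; ring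
    rw [h3]
    push_cast at h2 ⊢
    rw [h]
    have e : (2*(n:ℝ)+3) * (cc M / (2*M-2*(n+1)-1)) = (2*n+2) * (cc M / (2*M-2*n-1)) + 2 * (M * cc M / (2*M-2*(n+1)-1)) - 2 * ((2*M+1)*cc M/2/(2*M-2*n-1)) := by
      rw [← sub_eq_zero]
      generalize hx : 2*(M:ℝ)-2*n-1 = x at *
      have h5 : 2*(M:ℝ)-2*(n+1)-1 = x-2 := by rw [← hx]; ring
      rw [h5] at h2 ⊢
      have h6 : (n:ℝ) = (2*M-1-x)/2 := by linarith
      rw [h6]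
      field_simp
      ring
    linarith

open Filter Topology in
lemma TT_tendsto (n : ℕ) : Tendsto (TT n) atTop (𝓝 0) := by
  induction n with
  | zero =>
    have := ((bdry 0).const_mul 2).neg
    simp only [mul_zero, neg_zero] at this
    exact this.congr fun M => (TT_zero M).symm
  | succ n ih =>
    have := ((ih.const_mul (2*(n:ℝ)+2)).sub ((bdry (n+1)).const_mul 2)).const_mul (2*(n:ℝ)+3)⁻¹
    simp only [mul_zero, sub_zero] at this
    refine this.congr fun M => ?_
    rw [← TT_succ, inv_mul_cancel_left₀ (by positivity)]

lemma part (n M : ℕ) : ∑ m ∈ Finset.range M, (2*(m:ℝ)+1) * cc m / ((2*((m:ℝ)-n))^2-1) =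
    (1/2) * TT n M - M * cc M / (2*M - 2*n-1) := by
  induction M with
  | zero => simp [TT]
  | succ M ih =>
    have h1 := odd_ne M n
    have h2 := odd_ne' M n
    have h : ((M:ℝ)+1) * cc (M+1) = (2*M+1)*cc M/2 := by linarith [cc_rec M]
    unfold TT at *
    rw [Finset.sum_range_succ, Finset.sum_range_succ, ih]
    have h3 : 2*((M+1:ℕ):ℝ)-2*n-1 = 2*M - 2*n+1 := by push_cast; ring
    have h4 : (2*((M:ℝ)-n))^2-1 = (2*M-2*n-1)*(2*M-2*n+1) := by ring
    rw [h3, h4]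
    push_cast
    rw [h]
    have e : (2*(M:ℝ)+1) * cc M / ((2*M-2*n-1)*(2*M-2*n+1)) = 1/2*(cc M / (2*M-2*n-1)) + M * cc M / (2*M-2*n-1) - (2*M+1)*cc M/2/(2*M-2*n+1) := by
      generalize hx : 2*(M:ℝ)-2*n-1 = x at *
      have h5 : 2*(M:ℝ)-2*n+1 = x+2 := by rw [← hx]; ring
      rw [h5] at h2 ⊢
      field_simp
      ring
    rw [e]; ring

open Filter Topology in
lemma hasSum_a (n : ℕ) : HasSum (fun m : ℕ => (2*(m:ℝ)+1) * cc m * nuSym (2*((m:ℤ)-n))) ((2*n+1) * cc n) := by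
  rw [hasSum_iff_tendsto_nat_of_nonneg]
  · have h := (((TT_tendsto n).const_mul (1/2)).sub (bdry n)).add_const ((2*n+1) * cc n)
    simp only [mul_zero, sub_zero, zero_add] at h
    refine h.congr' ?_
    filter_upwards [eventually_gt_atTop n] with M hM
    rw [← part]
    have : (2*(n:ℝ)+1) * cc n = ∑ m ∈ Finset.range M, if m = n then (2*(n:ℝ)+1) * cc n else 0 := by
      rw [Finset.sum_ite_eq', if_pos (Finset.mem_range.mpr hM)]
    rw [this, ← Finset.sum_add_distrib]
    apply Finset.sum_congr rfl
    intro m _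
    by_cases hm : m = n
    · subst hm; simp [nuSym]; ring
    · have : (m:ℤ) - n ≠ 0 := by omega
      simp [hm, nuSym, this, div_eq_mul_inv]
  · intro m
    have := cc_nonneg m
    have := nu_nonneg (2*((m:ℤ)-n))
    positivity

lemma harm : NuHarmonic nuSym (h1 1) := by
  refine ⟨h1_nonneg, ?_⟩
  intro k hk
  obtain ⟨n, hn⟩ : ∃ n : ℕ, k = 2*n+1 ∨ k = 2*n+2 := ⟨((k-1)/2).toNat, by omega⟩
  have hinj : Function.Injective (fun m : ℕ => 2*((m:ℤ)-n)) := fun a b h => by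
    simp at h; exact h
  rw [← hinj.hasSum_iff]
  · have h := hasSum_a n
    rcases hn with rfl | rfl
    · rw [h1_odd]
      refine (congrArg (fun f => HasSum f _) ?_).mpr h
      funext m
      simp only [Function.comp]
      rw [show 2*(n:ℤ)+1+2*((m:ℤ)-n) = 2*m+1 by ring, h1_odd]
    · rw [h1_even]
      refine (congrArg (fun f => HasSum f _) ?_).mpr h
      funext m
      simp only [Function.comp]
      rw [show 2*(n:ℤ)+2+2*((m:ℤ)-n) = 2*m+2 by ring, h1_even]
  · intro l hl
    by_cases h2 : (2:ℤ) ∣ l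
    · rw [h1_neg, zero_mul]
      by_contra hc
      apply hl
      obtain ⟨j, rfl⟩ := h2
      refine ⟨(j+n).toNat, ?_⟩
      dsimp only
      omega
    · have : nuSym l = 0 := by
        unfold nuSym
        rw [if_neg (fun h => h2 h.2)]
      rw [this, mul_zero]

/-- a symmetric critical random walk with Cauchy-type tails. -/
theorem stmt19 :
    IsProbDist nuSym ∧
    (∀ k : ℤ, nuSym (-k) = nuSym k) ∧
    (∀ θ : ℝ, phiNu nuSym θ = ((1 - Real.pi / 2 * |Real.sin θ| : ℝ) : ℂ)) ∧
    NuHarmonic nuSym (h1 1) := by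
  refine ⟨nu_prob, ?_, fun θ => (hasSum_nu θ).tsum_eq, harm⟩
  intro k
  simp [nuSym]
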